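/- arXiv:1206.3204 — 5 statements merged into one kernel-verified Lean document; each statement's English description precedes it below -/
import Mathlib

section
/- Let A, Â, C be n×d real matrices such that rank(C) ≤ k, rank(Â) ≤ k, ‖A − Â‖ ≤ ‖A − C‖, and ‖A − Â‖_F ≤ ‖A − C‖_F. Then ‖Â − C‖_F² ≤ 8·k·‖A − C‖² and ‖Â − C‖_F² ≤ 8·‖A − C‖_F². -/
open Finset
open scoped Classical

noncomputable section

/-- Spectral (ℓ₂ operator) norm of a real matrix. -/
def specNorm {m p : Type*} [Fintype m] [Fintype p] [DecidableEq p] (M : Matrix m p ℝ) : ℝ :=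
  ‖LinearMap.toContinuousLinearMap (Matrix.toEuclideanLin M)‖

/-- Frobenius norm of a real matrix. -/
def frobNorm {m p : Type*} [Fintype m] [Fintype p] (M : Matrix m p ℝ) : ℝ :=
  Real.sqrt (∑ i, ∑ j, (M i j) ^ 2)

variable {n d k : ℕ}

/-- The i-th row of a matrix, viewed as a point of Euclidean space. -/
def row (M : Matrix (Fin n) (Fin d) ℝ) (i : Fin n) : EuclideanSpace ℝ (Fin d) :=
  (WithLp.equiv 2 (Fin d → ℝ)).symm (M i)

/-- The set of indices assigned to cluster `r` by the clustering `τ`. -/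
def cluster (τ : Fin n → Fin k) (r : Fin k) : Finset (Fin n) :=
  Finset.univ.filter fun i => τ i = r

/-- The size `n_r` of cluster `r`. -/
def clusterSize (τ : Fin n → Fin k) (r : Fin k) : ℕ := (cluster τ r).card

/-- The mean of the rows of `M` indexed by `S`. -/
def meanOf (M : Matrix (Fin n) (Fin d) ℝ) (S : Finset (Fin n)) : EuclideanSpace ℝ (Fin d) :=
  (S.card : ℝ)⁻¹ • ∑ i ∈ S, row M i

/-- The mean `μ_r` of cluster `r`. -/
def mu (A : Matrix (Fin n) (Fin d) ℝ) (τ : Fin n → Fin k) (r : Fin k) :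
    EuclideanSpace ℝ (Fin d) :=
  meanOf A (cluster τ r)

/-- The matrix `C` whose i-th row is the mean of the cluster containing `i`. -/
def centerMatrix (A : Matrix (Fin n) (Fin d) ℝ) (τ : Fin n → Fin k) :
    Matrix (Fin n) (Fin d) ℝ :=
  fun i j => mu A τ (τ i) j

/-- `Δ_r = (1/√n_r) · min {√k·‖A−C‖, ‖A−C‖_F}`. -/
def Delta (A : Matrix (Fin n) (Fin d) ℝ) (τ : Fin n → Fin k) (r : Fin k) : ℝ :=
  (Real.sqrt (clusterSize τ r))⁻¹ *
    min (Real.sqrt k * specNorm (A - centerMatrix A τ)) (frobNorm (A - centerMatrix A τ))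

end

/-- The squared Frobenius norm is the sum of the squared entries. -/
theorem frobNorm_sq {m p : Type*} [Fintype m] [Fintype p] (M : Matrix m p ℝ) :
    frobNorm M ^ 2 = ∑ i, ∑ j, (M i j) ^ 2 :=
  Real.sq_sqrt (Finset.sum_nonneg fun _ _ => Finset.sum_nonneg fun _ _ => sq_nonneg _)

theorem frobNorm_sub_sq_le {m p : Type*} [Fintype m] [Fintype p] (A B : Matrix m p ℝ) :
    frobNorm (A - B) ^ 2 ≤ 2 * frobNorm A ^ 2 + 2 * frobNorm B ^ 2 := by
  simp only [frobNorm_sq, Finset.mul_sum, ← Finset.sum_add_distrib]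
  refine Finset.sum_le_sum fun i _ => Finset.sum_le_sum fun j _ => ?_
  rw [Matrix.sub_apply]
  nlinarith [sq_nonneg (A i j + B i j)]

theorem specNorm_sub_le {m p : Type*} [Fintype m] [Fintype p] [DecidableEq p]
    (A B : Matrix m p ℝ) : specNorm (A - B) ≤ specNorm A + specNorm B := by
  unfold specNorm
  rw [map_sub, map_sub]
  exact norm_sub_le _ _

open scoped Matrix.Norms.L2Operator in
/-- The eigenvalues of the Gram matrix are bounded by the squared spectral norm. -/
theorem eigenvalues_gram_le_specNorm_sq {m p : Type*} [Fintype m] [Fintype p] [DecidableEq p]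
    (M : Matrix m p ℝ) (i : p) :
    (Matrix.isHermitian_conjTranspose_mul_self M).eigenvalues i ≤ specNorm M ^ 2 := by
  set hM := Matrix.isHermitian_conjTranspose_mul_self M
  have h := Matrix.l2_opNorm_mulVec (M.conjTranspose * M) (hM.eigenvectorBasis i)
  rw [hM.mulVec_eigenvectorBasis, Matrix.l2_opNorm_conjTranspose_mul_self, map_smul, norm_smul,
    PiLp.continuousLinearEquiv_symm_apply, WithLp.toLp_ofLp, hM.eigenvectorBasis.norm_eq_one, mul_one, mul_one,
    Matrix.l2_opNorm_def, ← sq] at h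
  exact (le_abs_self _).trans h

theorem frobNorm_sq_le_rank_mul_specNorm_sq {m p : Type*} [Fintype m] [Fintype p]
    [DecidableEq p] (M : Matrix m p ℝ) :
    frobNorm M ^ 2 ≤ M.rank * specNorm M ^ 2 := by
  have hM := Matrix.isHermitian_conjTranspose_mul_self M
  have htrace : frobNorm M ^ 2 = ∑ i, hM.eigenvalues i := by
    have h := hM.trace_eq_sum_eigenvalues
    simp only [RCLike.ofReal_real_eq_id, id] at h
    rw [← h, frobNorm_sq, Finset.sum_comm]
    simp [Matrix.trace, Matrix.mul_apply, sq]
  have hrank : M.rank = (Finset.univ.filter fun i => hM.eigenvalues i ≠ 0).card := by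
    rw [← Matrix.rank_conjTranspose_mul_self, hM.rank_eq_card_non_zero_eigs, Fintype.card_subtype]
  rw [htrace, hrank, ← Finset.sum_filter_ne_zero, ← nsmul_eq_mul]
  exact Finset.sum_le_card_nsmul _ _ _ fun i _ => eigenvalues_gram_le_specNorm_sq M i

theorem rank_sub_le {m p : Type*} [Fintype m] [Fintype p] (A B : Matrix m p ℝ) :
    (A - B).rank ≤ A.rank + B.rank := by
  have hle : LinearMap.range (A - B).mulVecLin ≤
      LinearMap.range A.mulVecLin ⊔ LinearMap.range B.mulVecLin := by
    rintro _ ⟨x, rfl⟩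
    rw [Matrix.mulVecLin_apply, Matrix.sub_mulVec]
    exact Submodule.sub_mem_sup ⟨x, rfl⟩ ⟨x, rfl⟩
  exact (Submodule.finrank_mono hle).trans (Submodule.finrank_add_le_finrank_add_finrank _ _)

/-- If `rank C ≤ k`, `rank Â ≤ k`, `‖A − Â‖ ≤ ‖A − C‖` (spectral norms) and
`‖A − Â‖_F ≤ ‖A − C‖_F`, then `‖Â − C‖_F² ≤ 8k‖A − C‖²` and `‖Â − C‖_F² ≤ 8‖A − C‖_F²`. -/
theorem stmt0 {n d k : ℕ} (A Ahat C : Matrix (Fin n) (Fin d) ℝ)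
    (hrankC : C.rank ≤ k) (hrankAhat : Ahat.rank ≤ k)
    (hspec : specNorm (A - Ahat) ≤ specNorm (A - C))
    (hfrob : frobNorm (A - Ahat) ≤ frobNorm (A - C)) :
    frobNorm (Ahat - C) ^ 2 ≤ 8 * k * specNorm (A - C) ^ 2 ∧
      frobNorm (Ahat - C) ^ 2 ≤ 8 * frobNorm (A - C) ^ 2 := by
  constructor
  · have hrank : ((Ahat - C).rank : ℝ) ≤ 2 * k := by
      have h := rank_sub_le Ahat C
      exact_mod_cast (by omega : (Ahat - C).rank ≤ 2 * k)
    have hnonneg : 0 ≤ specNorm (Ahat - C) := norm_nonneg _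
    have hnorm : specNorm (Ahat - C) ≤ 2 * specNorm (A - C) := by
      have h := specNorm_sub_le (A - C) (A - Ahat)
      rw [sub_sub_sub_cancel_left] at h
      linarith
    calc frobNorm (Ahat - C) ^ 2
        ≤ (Ahat - C).rank * specNorm (Ahat - C) ^ 2 := frobNorm_sq_le_rank_mul_specNorm_sq _
      _ ≤ (2 * k) * (2 * specNorm (A - C)) ^ 2 := by gcongr
      _ = 8 * k * specNorm (A - C) ^ 2 := by ring
  · have h := frobNorm_sub_sq_le (A - C) (A - Ahat)
    rw [sub_sub_sub_cancel_left] at h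
    have hsq : frobNorm (A - Ahat) ^ 2 ≤ frobNorm (A - C) ^ 2 :=
      pow_le_pow_left₀ (Real.sqrt_nonneg _) hfrob 2
    linarith [sq_nonneg (frobNorm (A - C))]
end

section
/- Let Â be any n×d real matrix satisfying ‖Â − C‖_F² ≤ 8·n_r·Δ_r² for every cluster index r, and let ν_1,…,ν_k ∈ ℝ^d be centers whose k-means cost on the rows of Â satisfies Σ_{i=1}^n min_{1≤s≤k} ‖Â_i − ν_s‖² ≤ 10·n_r·Δ_r² for every r. Then for every r there exists s such that ‖μ_r − ν_s‖ ≤ 6·Δ_r. -/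
open Finset
open scoped Classical

theorem Delta_nonneg {n d k : ℕ} (A : Matrix (Fin n) (Fin d) ℝ) (τ : Fin n → Fin k) (r : Fin k) :
    0 ≤ Delta A τ r := by
  unfold Delta specNorm frobNorm
  positivity

theorem row_centerMatrix {n d k : ℕ} (A : Matrix (Fin n) (Fin d) ℝ) (τ : Fin n → Fin k)
    (i : Fin n) : row (centerMatrix A τ) i = mu A τ (τ i) :=
  rfl

theorem frobNorm_sub_sq {n d : ℕ} (M N : Matrix (Fin n) (Fin d) ℝ) :
    frobNorm (M - N) ^ 2 = ∑ i, ‖row M i - row N i‖ ^ 2 := by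
  rw [frobNorm, Real.sq_sqrt (by positivity)]
  simp [EuclideanSpace.norm_sq_eq, row]

theorem norm_sub_sq_le_two_mul {E : Type*} [SeminormedAddCommGroup E] (x y z : E) :
    ‖x - z‖ ^ 2 ≤ 2 * ‖y - x‖ ^ 2 + 2 * ‖y - z‖ ^ 2 := by
  have h : ‖x - z‖ ≤ ‖y - x‖ + ‖y - z‖ := by
    simpa [norm_sub_rev y x] using norm_sub_le_norm_sub_add_norm_sub x y z
  nlinarith [sq_nonneg (‖y - x‖ - ‖y - z‖), norm_nonneg (x - z)]

/-- If `‖Â − C‖_F² ≤ 8·n_r·Δ_r²` for every `r` and the centers `ν_1,…,ν_k` have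
k-means cost at most `10·n_r·Δ_r²` on the rows of `Â` for every `r`, then every true mean `μ_r`
is within `6·Δ_r` of some `ν_s`. -/
theorem stmt1 {n d k : ℕ} (hk : 2 ≤ k) (A Ahat : Matrix (Fin n) (Fin d) ℝ)
    (τ : Fin n → Fin k) (hfib : ∀ r, (cluster τ r).Nonempty)
    (hAhat : ∀ r, frobNorm (Ahat - centerMatrix A τ) ^ 2 ≤
      8 * clusterSize τ r * Delta A τ r ^ 2)
    (ν : Fin k → EuclideanSpace ℝ (Fin d))
    (hcost : ∀ r, (∑ i, ⨅ s : Fin k, ‖row Ahat i - ν s‖ ^ 2) ≤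
      10 * clusterSize τ r * Delta A τ r ^ 2) :
    ∀ r, ∃ s, ‖mu A τ r - ν s‖ ≤ 6 * Delta A τ r := by
  intro r
  by_contra! hfar
  have : Nonempty (Fin k) := ⟨r⟩
  have hΔ := Delta_nonneg A τ r
  have hpoint : ∀ i ∈ cluster τ r, 18 * Delta A τ r ^ 2 <
      ‖row Ahat i - row (centerMatrix A τ) i‖ ^ 2 + ⨅ s, ‖row Ahat i - ν s‖ ^ 2 := by
    intro i hi
    have hi : τ i = r := by simpa [cluster] using hi
    obtain ⟨s, hs⟩ := exists_eq_ciInf_of_finite (f := fun s => ‖row Ahat i - ν s‖ ^ 2)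
    rw [row_centerMatrix, hi, ← hs]
    have h := norm_sub_sq_le_two_mul (mu A τ r) (row Ahat i) (ν s)
    nlinarith [hfar s]
  have hsum := Finset.sum_lt_sum_of_nonempty (hfib r) hpoint
  have hle := Finset.sum_le_univ_sum_of_nonneg (s := cluster τ r)
    (f := fun i => ‖row Ahat i - row (centerMatrix A τ) i‖ ^ 2 + ⨅ s, ‖row Ahat i - ν s‖ ^ 2)
    fun i => add_nonneg (sq_nonneg _) (Real.iInf_nonneg fun s => sq_nonneg _)
  rw [Finset.sum_add_distrib (s := univ), ← frobNorm_sub_sq] at hle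
  rw [Finset.sum_const, nsmul_eq_mul] at hsum
  have hA := hAhat r
  have hC := hcost r
  unfold clusterSize at hA hC
  linarith
end

section
/- Fix a cluster index r and let S be a set of row indices obtained from T_r by removing ρ_out·n_r points of T_r and adding, for each s ≠ r, ρ_in(s)·n_r points of T_s (so S ∩ T_r has (1−ρ_out)·n_r elements, S ∩ T_s has ρ_in(s)·n_r elements for s ≠ r, and S ⊆ T_1 ∪ … ∪ T_k). Assume ρ_out < 1/4 and Σ_{s≠r} ρ_in(s) < 1/4, and assume that for every s ≠ r with S ∩ T_s nonempty, the mean μ(S ∩ T_s) = (1/|S∩T_s|)·Σ_{i∈S∩T_s} A_i satisfies ‖μ(S∩T_s) − μ_r‖ ≤ (3/2)·‖μ(S∩T_s) − μ_s‖. Then ‖μ(S) − μ_r‖ ≤ (2/√n_r)·(√ρ_out + Σ_{s≠r} √(ρ_in(s)))·‖A − C‖, where μ(S) = (1/|S|)·Σ_{i∈S} A_i. -/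
open Finset
open scoped Classical

/-- The spectral norm bounds the length of a sum of rows. -/
theorem norm_sum_row_le {n d : ℕ} (M : Matrix (Fin n) (Fin d) ℝ) (U : Finset (Fin n)) :
    ‖∑ i ∈ U, row M i‖ ≤ Real.sqrt U.card * specNorm M := by
  set v := ∑ i ∈ U, row M i with hv
  set w : EuclideanSpace ℝ (Fin n) := Matrix.toEuclideanLin M v with hw
  have hwv : ‖w‖ ≤ specNorm M * ‖v‖ :=
    (LinearMap.toContinuousLinearMap (Matrix.toEuclideanLin M)).le_opNorm v
  have hrow : ∀ i, inner ℝ (row M i) v = w i := by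
    intro i
    simp [hw, row, PiLp.inner_apply, Matrix.toLpLin_apply, Matrix.mulVec, dotProduct, mul_comm]
  have hsq : ‖v‖ ^ 2 = ∑ i ∈ U, w i := by
    rw [← real_inner_self_eq_norm_sq]
    conv_lhs => rw [hv, sum_inner]
    exact Finset.sum_congr rfl fun i _ => hrow i
  have hsum : ∑ i ∈ U, w i ≤ Real.sqrt U.card * ‖w‖ := by
    rw [EuclideanSpace.norm_eq, ← Real.sqrt_mul (Nat.cast_nonneg _)]
    apply Real.le_sqrt_of_sq_le
    refine sq_sum_le_card_mul_sum_sq.trans ?_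
    gcongr
    simp only [Real.norm_eq_abs, sq_abs]
    exact Finset.sum_le_univ_sum_of_nonneg fun i => sq_nonneg _
  rcases (norm_nonneg v).eq_or_lt with h0 | hpos
  · rw [← h0]
    exact mul_nonneg (Real.sqrt_nonneg _) (norm_nonneg _)
  · refine le_of_mul_le_mul_right ?_ hpos
    calc ‖v‖ * ‖v‖ = ∑ i ∈ U, w i := by rw [← hsq, sq]
      _ ≤ Real.sqrt U.card * (specNorm M * ‖v‖) := by
        refine hsum.trans ?_
        gcongr
      _ = Real.sqrt U.card * specNorm M * ‖v‖ := by ring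

theorem card_smul_meanOf {n d : ℕ} (M : Matrix (Fin n) (Fin d) ℝ) (S : Finset (Fin n)) :
    (S.card : ℝ) • meanOf M S = ∑ i ∈ S, row M i := by
  rcases S.eq_empty_or_nonempty with rfl | h
  · simp
  · have : (S.card : ℝ) ≠ 0 := by exact_mod_cast h.card_pos.ne'
    rw [meanOf, smul_inv_smul₀ this]

theorem card_smul_meanOf_sub {n d : ℕ} (M : Matrix (Fin n) (Fin d) ℝ) (S : Finset (Fin n))
    (x : EuclideanSpace ℝ (Fin d)) :
    (S.card : ℝ) • (meanOf M S - x) = ∑ i ∈ S, (row M i - x) := by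
  rw [smul_sub, card_smul_meanOf, Finset.sum_sub_distrib, Finset.sum_const, Nat.cast_smul_eq_nsmul]

theorem row_sub_centerMatrix {n d k : ℕ} (A : Matrix (Fin n) (Fin d) ℝ) (τ : Fin n → Fin k)
    (i : Fin n) : row (A - centerMatrix A τ) i = row A i - mu A τ (τ i) := by
  ext j
  simp [row, centerMatrix]

/-- Within a single cluster, deviations from the cluster mean sum to a vector controlled by the
spectral norm of `A - C`. -/
theorem norm_sum_row_sub_mu_le {n d k : ℕ} (A : Matrix (Fin n) (Fin d) ℝ) (τ : Fin n → Fin k)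
    (s : Fin k) (U : Finset (Fin n)) (hU : U ⊆ cluster τ s) :
    ‖∑ i ∈ U, (row A i - mu A τ s)‖ ≤
      Real.sqrt U.card * specNorm (A - centerMatrix A τ) := by
  refine le_of_eq_of_le ?_ (norm_sum_row_le (A - centerMatrix A τ) U)
  congr 1
  refine Finset.sum_congr rfl fun i hi => ?_
  have : τ i = s := by simpa [cluster] using hU hi
  rw [row_sub_centerMatrix, this]

/-- A sum over `S` splits along the clusters. -/
theorem sum_inter_cluster {n k : ℕ} {E : Type*} [AddCommMonoid E] (τ : Fin n → Fin k)
    (S : Finset (Fin n)) (r : Fin k) (f : Fin n → E) :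
    ∑ i ∈ S, f i = ∑ i ∈ S ∩ cluster τ r, f i +
      ∑ s ∈ Finset.univ.erase r, ∑ i ∈ S ∩ cluster τ s, f i := by
  rw [Finset.add_sum_erase _ (fun s => ∑ i ∈ S ∩ cluster τ s, f i) (Finset.mem_univ r),
    ← Finset.sum_fiberwise S τ f]
  refine Finset.sum_congr rfl fun s _ => Finset.sum_congr ?_ fun _ _ => rfl
  ext i
  simp [cluster]

/-- the mean of a set `S` obtained from `T_r` by removing a `ρ_out` fraction of its
points and adding a `ρ_in(s)` fraction (of `n_r`) of points from each other cluster `T_s` is close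
to `μ_r`. -/
theorem stmt2 {n d k : ℕ} (hk : 2 ≤ k) (A : Matrix (Fin n) (Fin d) ℝ)
    (τ : Fin n → Fin k) (hfib : ∀ r, (cluster τ r).Nonempty)
    (r : Fin k) (S : Finset (Fin n)) (ρout : ℝ) (ρin : Fin k → ℝ)
    (hout : ((S ∩ cluster τ r).card : ℝ) = (1 - ρout) * clusterSize τ r)
    (hin : ∀ s, s ≠ r → ((S ∩ cluster τ s).card : ℝ) = ρin s * clusterSize τ r)
    (hout4 : ρout < 1 / 4)
    (hin4 : ∑ s ∈ Finset.univ.erase r, ρin s < 1 / 4)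
    (hmean : ∀ s, s ≠ r → (S ∩ cluster τ s).Nonempty →
      ‖meanOf A (S ∩ cluster τ s) - mu A τ r‖ ≤
        (3 / 2) * ‖meanOf A (S ∩ cluster τ s) - mu A τ s‖) :
    ‖meanOf A S - mu A τ r‖ ≤
      2 / Real.sqrt (clusterSize τ r) *
        (Real.sqrt ρout + ∑ s ∈ Finset.univ.erase r, Real.sqrt (ρin s)) *
        specNorm (A - centerMatrix A τ) := by
  set m : ℝ := (clusterSize τ r : ℝ) with hm
  set σ : ℝ := specNorm (A - centerMatrix A τ) with hσ
  have hσ0 : 0 ≤ σ := norm_nonneg _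
  have hmpos : 0 < m := Nat.cast_pos.2 (hfib r).card_pos
  have hin0 : ∀ s, s ≠ r → 0 ≤ ρin s := fun s hs =>
    nonneg_of_mul_nonneg_left ((hin s hs) ▸ Nat.cast_nonneg _) hmpos
  have hcard : (S.card : ℝ) = (1 - ρout) * m + ∑ s ∈ Finset.univ.erase r, ρin s * m := by
    have h := sum_inter_cluster τ S r (fun _ => (1 : ℝ))
    simp only [Finset.sum_const, nsmul_eq_mul, mul_one] at h
    rw [h, hout]
    congr 1
    exact Finset.sum_congr rfl fun s hs => hin s (Finset.ne_of_mem_erase hs)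
  have hcard_ge : 3 / 4 * m ≤ S.card := by
    have : 0 ≤ ∑ s ∈ Finset.univ.erase r, ρin s * m := Finset.sum_nonneg fun s hs =>
      mul_nonneg (hin0 s (Finset.ne_of_mem_erase hs)) hmpos.le
    nlinarith
  have hremoved : ((cluster τ r \ S).card : ℝ) = ρout * m := by
    have h := Finset.card_sdiff_add_card_inter (cluster τ r) S
    rw [Finset.inter_comm] at h
    have h' : ((cluster τ r \ S).card : ℝ) + (S ∩ cluster τ r).card = m := by
      rw [hm, clusterSize]
      exact_mod_cast h
    linarith
  have hkept : ‖∑ i ∈ S ∩ cluster τ r, (row A i - mu A τ r)‖ ≤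
      Real.sqrt ρout * Real.sqrt m * σ := by
    have hzero : ∑ i ∈ cluster τ r, (row A i - mu A τ r) = 0 := by
      rw [← card_smul_meanOf_sub, mu, sub_self, smul_zero]
    have hsplit := Finset.sum_inter_add_sum_sdiff (cluster τ r) S
      (fun i => row A i - mu A τ r)
    rw [hzero, Finset.inter_comm] at hsplit
    rw [eq_neg_of_add_eq_zero_left hsplit, norm_neg, ← Real.sqrt_mul' _ hmpos.le, ← hremoved]
    exact norm_sum_row_sub_mu_le A τ r _ Finset.sdiff_subset
  have hadded : ∀ s, s ≠ r → ‖∑ i ∈ S ∩ cluster τ s, (row A i - mu A τ r)‖ ≤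
      3 / 2 * (Real.sqrt (ρin s) * Real.sqrt m * σ) := by
    intro s hs
    rcases (S ∩ cluster τ s).eq_empty_or_nonempty with he | hne
    · rw [he, Finset.sum_empty, norm_zero]
      positivity
    · have h := norm_sum_row_sub_mu_le A τ s (S ∩ cluster τ s) Finset.inter_subset_right
      rw [← card_smul_meanOf_sub, norm_smul, hin s hs, Real.sqrt_mul' _ hmpos.le] at h
      rw [← card_smul_meanOf_sub, norm_smul, hin s hs]
      calc _ ≤ ‖ρin s * m‖ * (3 / 2 * ‖meanOf A (S ∩ cluster τ s) - mu A τ s‖) := by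
            gcongr
            exact hmean s hs hne
        _ ≤ _ := by linarith
  have htotal : S.card * ‖meanOf A S - mu A τ r‖ ≤
      3 / 2 * ((Real.sqrt ρout + ∑ s ∈ Finset.univ.erase r, Real.sqrt (ρin s)) *
        Real.sqrt m * σ) := by
    calc S.card * ‖meanOf A S - mu A τ r‖
        = ‖∑ i ∈ S, (row A i - mu A τ r)‖ := by
          rw [← card_smul_meanOf_sub, norm_smul, Real.norm_natCast]
      _ ≤ Real.sqrt ρout * Real.sqrt m * σ +
          ∑ s ∈ Finset.univ.erase r, 3 / 2 * (Real.sqrt (ρin s) * Real.sqrt m * σ) := by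
          rw [sum_inter_cluster τ S r]
          exact (norm_add_le _ _).trans (add_le_add hkept (norm_sum_le_of_le _ fun s hs =>
            hadded s (Finset.ne_of_mem_erase hs)))
      _ ≤ _ := by
          rw [← Finset.mul_sum, ← Finset.sum_mul, ← Finset.sum_mul]
          have : 0 ≤ Real.sqrt ρout * Real.sqrt m * σ := by positivity
          linarith
  refine le_of_mul_le_mul_left ?_ (show 0 < 3 / 4 * m by positivity)
  calc 3 / 4 * m * ‖meanOf A S - mu A τ r‖ ≤ S.card * ‖meanOf A S - mu A τ r‖ := by gcongr
    _ ≤ _ := htotal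
    _ = _ := by
      have hs : Real.sqrt m ≠ 0 := (Real.sqrt_pos.2 hmpos).ne'
      have hsm : Real.sqrt m ^ 2 = m := Real.sq_sqrt hmpos.le
      conv_rhs => rw [show 3 / 4 * m = 3 / 4 * Real.sqrt m ^ 2 by rw [hsm]]
      field_simp
      ring
end

section
/- Assume c ≥ 48, center separation, and centers ν_1,…,ν_k ∈ ℝ^d with ‖μ_t − ν_t‖ ≤ 6·Δ_t for every t. Let r ≠ s be cluster indices and let x ∈ ℝ^d be any point with ‖x − ν_r‖ ≤ ‖x − ν_s‖. Then ‖x − μ_s‖ ≥ (c/4)·(Δ_r + Δ_s). -/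
open Finset
open scoped Classical

/-- under center separation (with `c ≥ 48`) and matched centers `ν_t` with
`‖μ_t − ν_t‖ ≤ 6Δ_t`, any point `x` at least as close to `ν_r` as to `ν_s` (with `r ≠ s`)
satisfies `‖x − μ_s‖ ≥ (c/4)·(Δ_r + Δ_s)`. -/
theorem stmt7 {n d k : ℕ} (hk : 2 ≤ k) (A : Matrix (Fin n) (Fin d) ℝ)
    (τ : Fin n → Fin k) (hfib : ∀ r, (cluster τ r).Nonempty)
    (c : ℝ) (hc : 48 ≤ c)
    (hAC : A ≠ centerMatrix A τ)
    (hsep : ∀ r s, r ≠ s → c * (Delta A τ r + Delta A τ s) ≤ ‖mu A τ r - mu A τ s‖)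
    (ν : Fin k → EuclideanSpace ℝ (Fin d))
    (hν : ∀ t, ‖mu A τ t - ν t‖ ≤ 6 * Delta A τ t)
    (r s : Fin k) (hrs : r ≠ s)
    (x : EuclideanSpace ℝ (Fin d)) (hx : ‖x - ν r‖ ≤ ‖x - ν s‖) :
    c / 4 * (Delta A τ r + Delta A τ s) ≤ ‖x - mu A τ s‖ := by
  have hr : 0 ≤ Delta A τ r := by linarith [hν r, norm_nonneg (mu A τ r - ν r)]
  have hs : 0 ≤ Delta A τ s := by linarith [hν s, norm_nonneg (mu A τ s - ν s)]
  have hμν : ‖mu A τ r - mu A τ s‖ ≤ ‖mu A τ r - ν r‖ + ‖x - ν r‖ + ‖x - mu A τ s‖ := by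
    have h₁ := norm_sub_le_norm_sub_add_norm_sub (mu A τ r) x (mu A τ s)
    have h₂ := norm_sub_le_norm_sub_add_norm_sub (mu A τ r) (ν r) x
    rw [norm_sub_rev (ν r) x] at h₂
    linarith
  have hxs := norm_sub_le_norm_sub_add_norm_sub x (mu A τ s) (ν s)
  have hcD := mul_le_mul_of_nonneg_right hc (add_nonneg hr hs)
  linarith [hsep r s hrs, hν r, hν s]
end

section
/- Let 0 < ε < 1 and suppose the dataset satisfies the ORSS-separation condition: for every choice of k−1 centers γ_1,…,γ_{k−1} ∈ ℝ^d, Σ_{i=1}^n min_{1≤t≤k−1} ‖A_i − γ_t‖² ≥ (1/ε)·‖A − C‖_F². Then for all cluster indices r ≠ s, ‖μ_r − μ_s‖ ≥ √(1/ε − 1)·‖A − C‖_F/√n_r. -/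
open Finset
open scoped Classical

/-- The parallel axis identity: the squared distances of the points `x i` to `c` split into
those to their mean and the squared distance of the mean to `c`. -/
theorem sum_norm_sub_sq_eq_sum_norm_sub_mean_sq_add {ι E : Type*} [NormedAddCommGroup E]
    [InnerProductSpace ℝ E] (S : Finset ι) (x : ι → E) (m c : E)
    (hm : ∑ i ∈ S, x i = (S.card : ℝ) • m) :
    ∑ i ∈ S, ‖x i - c‖ ^ 2 = ∑ i ∈ S, ‖x i - m‖ ^ 2 + S.card * ‖m - c‖ ^ 2 := by
  have hsum : ∑ i ∈ S, (x i - m) = 0 := by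
    rw [Finset.sum_sub_distrib, hm, Finset.sum_const, Nat.cast_smul_eq_nsmul, sub_self]
  have hexp (i : ι) :
      ‖x i - c‖ ^ 2 = ‖x i - m‖ ^ 2 + 2 * inner ℝ (x i - m) (m - c) + ‖m - c‖ ^ 2 := by
    rw [← norm_add_sq_real, sub_add_sub_cancel]
  simp_rw [hexp]
  rw [Finset.sum_add_distrib, Finset.sum_add_distrib, ← Finset.mul_sum, ← sum_inner, hsum,
    inner_zero_left, Finset.sum_const, nsmul_eq_mul]
  ring

theorem sum_row_cluster {n d k : ℕ} (A : Matrix (Fin n) (Fin d) ℝ) (τ : Fin n → Fin k)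
    {r : Fin k} (hr : (cluster τ r).Nonempty) :
    ∑ i ∈ cluster τ r, row A i = ((cluster τ r).card : ℝ) • mu A τ r := by
  have hcard : ((cluster τ r).card : ℝ) ≠ 0 := by exact_mod_cast hr.card_pos.ne'
  rw [mu, meanOf, smul_inv_smul₀ hcard]

theorem frobNorm_sub_centerMatrix_sq {n d k : ℕ} (A : Matrix (Fin n) (Fin d) ℝ)
    (τ : Fin n → Fin k) :
    frobNorm (A - centerMatrix A τ) ^ 2 = ∑ i, ‖row A i - mu A τ (τ i)‖ ^ 2 := by
  rw [frobNorm, Real.sq_sqrt (by positivity)]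
  simp [EuclideanSpace.norm_sq_eq, row, centerMatrix]

/-- Moving the points of cluster `r` to the center of another cluster `s` raises the `k`-means
cost by `n_r ‖μ_r - μ_s‖²`. -/
theorem sum_norm_row_sub_mu_merge_sq {n d k : ℕ} (A : Matrix (Fin n) (Fin d) ℝ)
    (τ : Fin n → Fin k) {r : Fin k} (hr : (cluster τ r).Nonempty) (s : Fin k) :
    ∑ i, ‖row A i - mu A τ (if τ i = r then s else τ i)‖ ^ 2 =
      frobNorm (A - centerMatrix A τ) ^ 2 + clusterSize τ r * ‖mu A τ r - mu A τ s‖ ^ 2 := by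
  have hin (f : Fin k → Fin k) : ∑ i ∈ cluster τ r, ‖row A i - mu A τ (f (τ i))‖ ^ 2 =
      ∑ i ∈ cluster τ r, ‖row A i - mu A τ (f r)‖ ^ 2 :=
    Finset.sum_congr rfl fun i hi ↦ by rw [(Finset.mem_filter.mp hi).2]
  have hout : ∑ i with ¬ τ i = r, ‖row A i - mu A τ (if τ i = r then s else τ i)‖ ^ 2 =
      ∑ i with ¬ τ i = r, ‖row A i - mu A τ (τ i)‖ ^ 2 :=
    Finset.sum_congr rfl fun i hi ↦ by rw [if_neg (Finset.mem_filter.mp hi).2]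
  have hmove := hin fun t ↦ if t = r then s else t
  have hstay := hin id
  have haxis := sum_norm_sub_sq_eq_sum_norm_sub_mean_sq_add (cluster τ r) (row A) (mu A τ r)
    (mu A τ s) (sum_row_cluster A τ hr)
  simp only [if_true, id] at hmove hstay
  rw [frobNorm_sub_centerMatrix_sq,
    ← Finset.sum_filter_add_sum_filter_not univ (fun i ↦ τ i = r),
    ← Finset.sum_filter_add_sum_filter_not univ (fun i ↦ τ i = r)
      (fun i ↦ ‖row A i - mu A τ (τ i)‖ ^ 2), hout]
  simp only [cluster, clusterSize] at *
  linarith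

/-- under the ORSS-separation condition (every `(k−1)`-means clustering costs at
least `(1/ε)·‖A − C‖_F²`), any two target means satisfy
`‖μ_r − μ_s‖ ≥ √(1/ε − 1)·‖A − C‖_F/√n_r`. -/
theorem stmt10 {n d k : ℕ} (hk : 2 ≤ k) (A : Matrix (Fin n) (Fin d) ℝ)
    (τ : Fin n → Fin k) (hfib : ∀ r, (cluster τ r).Nonempty)
    (ε : ℝ) (hε0 : 0 < ε) (hε1 : ε < 1)
    (horss : ∀ γ : Fin (k - 1) → EuclideanSpace ℝ (Fin d),
      (1 / ε) * frobNorm (A - centerMatrix A τ) ^ 2 ≤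
        ∑ i, ⨅ t : Fin (k - 1), ‖row A i - γ t‖ ^ 2)
    (r s : Fin k) (hrs : r ≠ s) :
    Real.sqrt (1 / ε - 1) * frobNorm (A - centerMatrix A τ) / Real.sqrt (clusterSize τ r) ≤
      ‖mu A τ r - mu A τ s‖ := by
  obtain ⟨m, rfl⟩ : ∃ m, k = m + 1 := ⟨k - 1, by omega⟩
  have hcost : ∑ i, ⨅ t : Fin (m + 1 - 1), ‖row A i - mu A τ (r.succAbove t)‖ ^ 2 ≤
      ∑ i, ‖row A i - mu A τ (if τ i = r then s else τ i)‖ ^ 2 := by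
    refine Finset.sum_le_sum fun i _ ↦ ?_
    have hne : (if τ i = r then s else τ i) ≠ r := by
      split_ifs with h
      exacts [hrs.symm, h]
    obtain ⟨t, ht⟩ := Fin.exists_succAbove_eq hne
    rw [← ht]
    exact ciInf_le (Set.finite_range _).bddBelow t
  have hsep := (horss fun t ↦ mu A τ (r.succAbove t)).trans hcost
  rw [sum_norm_row_sub_mu_merge_sq A τ (hfib r) s] at hsep
  have hsize : (0 : ℝ) < clusterSize τ r := by exact_mod_cast (hfib r).card_pos
  have hε : 0 ≤ 1 / ε - 1 := sub_nonneg.mpr (one_le_one_div hε0 hε1.le)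
  rw [div_le_iff₀ (Real.sqrt_pos.mpr hsize)]
  refine (abs_le_of_sq_le_sq' ?_ (by positivity)).2
  rw [mul_pow, mul_pow, Real.sq_sqrt hε, Real.sq_sqrt hsize.le]
  linarith
end
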